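/- Let (K, v) be a discretely valued field with valuation ring O_K and residue field k, and let f ∈ K[x] be a monic separable quartic polynomial. Then there exist α, β ∈ K with α ≠ 0 such that the equivalent quartic g(x) = α⁻⁴·f(α·x + β) satisfies: (a) all coefficients of g − x⁴ lie in O_K (i.e. λ(g) ≥ 0); (b) λ(g) < 1, i.e. writing g = x⁴ + d₁x³ + d₂x² + d₃x + d₄ one has v(dᵢ) < i for some i; and (c) if v(dᵢ) = 0 for some i (i.e. λ(g) = 0), then the image of g in k[x] is not the fourth power of a monic linear polynomial. In other words, every monic separable quartic over K is equivalent to a reduced quartic. -/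

import Mathlib

open Polynomial

section

variable {K : Type*} [Field K]

/-- The coefficients of `f(x + β)` in terms of those of `α⁻⁴·f(αx + β)`. -/
theorem coeff_taylor_eq_coeff_quartic_transform_mul (f : K[X]) {α : K} (β : K) (hα : α ≠ 0)
    {i : ℕ} (hi : i ≤ 4) :
    (taylor β f).coeff i =
      (C (α⁻¹ ^ 4) * f.comp (C α * X + C β)).coeff i * α ^ (4 - i) := by
  have hcomp : f.comp (C α * X + C β) = (taylor β f).comp (C α * X) := by
    rw [taylor_apply, comp_assoc]
    simp
  have hpow : α ^ i * α ^ (4 - i) = α ^ 4 := by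
    rw [← pow_add, Nat.add_sub_cancel' hi]
  rw [hcomp, coeff_C_mul, comp_C_mul_X_coeff]
  calc (taylor β f).coeff i = (taylor β f).coeff i * (α⁻¹ ^ 4 * α ^ 4) := by
        rw [← mul_pow, inv_mul_cancel₀ hα, one_pow, mul_one]
    _ = _ := by rw [← hpow]; ring

theorem quartic_transform_comp_X_add_C (f : K[X]) (α β a : K) :
    (C (α⁻¹ ^ 4) * f.comp (C α * X + C β)).comp (X + C a) =
      C (α⁻¹ ^ 4) * f.comp (C α * X + C (α * a + β)) := by
  simp only [mul_comp, C_comp, comp_assoc, add_comp, X_comp, C_add, C_mul]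
  ring_nf

variable (v : AddValuation K (WithTop ℤ))

theorem WithTop.exists_nonpos_int_le {x : WithTop ℤ} : ∃ B : ℤ, B ≤ 0 ∧ (B : WithTop ℤ) ≤ x := by
  cases x with
  | top => exact ⟨0, le_rfl, le_top⟩
  | coe n => exact ⟨min n 0, min_le_right _ _, by exact_mod_cast min_le_left _ _⟩

theorem AddValuation.map_pow_of_eq_coe {α : K} {n : ℤ} (hα : v α = (n : WithTop ℤ)) (k : ℕ) :
    v (α ^ k) = ((k * n : ℤ) : WithTop ℤ) := by
  rw [AddValuation.map_pow, hα, ← WithTop.coe_nsmul, nsmul_eq_mul]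

/-- The coefficients of a polynomial have a common lower bound for their valuations. -/
theorem AddValuation.exists_le_map_coeff (f : K[X]) (N : ℕ) :
    ∃ M : ℤ, M ≤ 0 ∧ ∀ i : ℕ, i < N → (M : WithTop ℤ) ≤ v (f.coeff i) := by
  choose B hB0 hB using fun i => WithTop.exists_nonpos_int_le (x := v (f.coeff i))
  refine ⟨∑ i ∈ Finset.range N, B i, Finset.sum_nonpos fun i _ => hB0 i, fun i hi =>
    le_trans (WithTop.coe_le_coe.2 ?_) (hB i)⟩
  rw [← Finset.add_sum_erase _ _ (Finset.mem_range.2 hi)]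
  exact add_le_of_nonpos_right (Finset.sum_nonpos fun j _ => hB0 j)

/-- A polynomial takes values of bounded below valuation on elements of bounded below
valuation. -/
theorem AddValuation.exists_le_map_eval (p : K[X]) (M : ℤ) :
    ∃ B : ℤ, ∀ b : K, (M : WithTop ℤ) ≤ v b → (B : WithTop ℤ) ≤ v (p.eval b) := by
  induction p using Polynomial.induction_on' with
  | add p q hp hq =>
    obtain ⟨B, hB⟩ := hp
    obtain ⟨B', hB'⟩ := hq
    refine ⟨min B B', fun b hb => ?_⟩
    rw [eval_add]
    refine v.map_le_add (le_trans ?_ (hB b hb)) (le_trans ?_ (hB' b hb))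
    · exact_mod_cast min_le_left _ _
    · exact_mod_cast min_le_right _ _
  | monomial n a =>
    obtain ⟨A, -, hA⟩ := WithTop.exists_nonpos_int_le (x := v a)
    refine ⟨A + n * M, fun b hb => ?_⟩
    rw [eval_monomial, v.map_mul, v.map_pow, WithTop.coe_add]
    refine add_le_add hA ?_
    have := nsmul_le_nsmul_right hb n
    rwa [← WithTop.coe_nsmul, nsmul_eq_mul] at this

/-- An element at which a monic quartic takes an integral value has valuation at least
that of any nonpositive bound for the coefficients. -/
theorem AddValuation.le_map_of_nonneg_map_eval {f : K[X]} (hmonic : f.Monic)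
    (hdeg : f.natDegree = 4) {M : ℤ} (hM : M ≤ 0)
    (hcoeff : ∀ i : ℕ, i < 4 → (M : WithTop ℤ) ≤ v (f.coeff i)) {b : K} (hb : 0 ≤ v (f.eval b)) :
    (M : WithTop ℤ) ≤ v b := by
  by_contra! hlt
  obtain ⟨m, hm⟩ := WithTop.ne_top_iff_exists.1 hlt.ne_top
  have hm' := hm.symm
  rw [← hm] at hlt
  have hlt' : m < M := by exact_mod_cast hlt
  have hterm : ∀ i : ℕ, i < 4 → ((4 * m + 1 : ℤ) : WithTop ℤ) ≤ v (f.coeff i * b ^ i) := by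
    intro i hi
    rw [v.map_mul, v.map_pow_of_eq_coe hm']
    refine le_trans ?_ (add_le_add_left (hcoeff i hi) _)
    norm_cast
    interval_cases i <;> push_cast <;> omega
  have heval : b ^ 4 = f.eval b - ∑ i ∈ Finset.range 4, f.coeff i * b ^ i := by
    have hlead : f.coeff 4 = 1 := hdeg ▸ hmonic.coeff_natDegree
    rw [eval_eq_sum_range, hdeg, Finset.sum_range_succ _ 4, hlead]
    ring
  have hle : ((4 * m + 1 : ℤ) : WithTop ℤ) ≤ v (b ^ 4) := by
    rw [heval]
    refine v.map_le_sub (le_trans ?_ hb) (v.map_le_sum fun i hi => hterm i (Finset.mem_range.1 hi))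
    norm_cast
    omega
  rw [v.map_pow_of_eq_coe hm'] at hle
  have : 4 * m + 1 ≤ 4 * m := by exact_mod_cast hle
  omega

/-- Separability bounds the `n` for which some `f(x + β)` has slopes at least `n`. -/
theorem AddValuation.exists_bound_of_separable_quartic {f : K[X]} (hmonic : f.Monic)
    (hdeg : f.natDegree = 4) (hsep : f.Separable) :
    ∃ N : ℤ, ∀ (n : ℤ) (β : K),
      (∀ i : ℕ, i < 4 → (((4 - i) * n : ℤ) : WithTop ℤ) ≤ v ((taylor β f).coeff i)) → n ≤ N := by
  obtain ⟨M, hM0, hM⟩ := v.exists_le_map_coeff f 4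
  obtain ⟨p, q, hpq⟩ := hsep
  obtain ⟨P, hP⟩ := v.exists_le_map_eval p M
  obtain ⟨Q, hQ⟩ := v.exists_le_map_eval q M
  refine ⟨max 0 (max (-P) (-Q)), fun n β hn => ?_⟩
  by_contra! hlt
  simp only [max_lt_iff] at hlt
  obtain ⟨hn0, hnP, hnQ⟩ := hlt
  have h0 := hn 0 (by norm_num)
  have h1 := hn 1 (by norm_num)
  rw [taylor_coeff_zero] at h0
  rw [taylor_coeff_one] at h1
  have hβ : (M : WithTop ℤ) ≤ v β := by
    refine v.le_map_of_nonneg_map_eval hmonic hdeg hM0 hM (le_trans (WithTop.coe_nonneg.2 ?_) h0)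
    push_cast
    omega
  have hone : p.eval β * f.eval β + q.eval β * (derivative f).eval β = 1 := by
    simpa using congrArg (eval β) hpq
  have hle : ((1 : ℤ) : WithTop ℤ) ≤ v (1 : K) := by
    rw [← hone]
    refine v.map_le_add ?_ ?_
    · rw [v.map_mul]
      refine le_trans ?_ (add_le_add (hP β hβ) h0)
      rw [← WithTop.coe_add, WithTop.coe_le_coe]
      push_cast
      omega
    · rw [v.map_mul]
      refine le_trans ?_ (add_le_add (hQ β hβ) h1)
      rw [← WithTop.coe_add, WithTop.coe_le_coe]
      push_cast
      omega
  rw [v.map_one] at hle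
  exact absurd hle (by norm_cast)

/-- Some translate of a monic quartic has all slopes at least `n`, with `n` maximal. -/
theorem AddValuation.exists_greatest_slope_bound {f : K[X]} (hmonic : f.Monic)
    (hdeg : f.natDegree = 4) (hsep : f.Separable) :
    ∃ n : ℤ,
      (∃ β : K, ∀ i : ℕ, i < 4 → (((4 - i) * n : ℤ) : WithTop ℤ) ≤ v ((taylor β f).coeff i)) ∧
      ∀ β : K, ¬ ∀ i : ℕ, i < 4 → (((4 - i) * (n + 1) : ℤ) : WithTop ℤ) ≤ v ((taylor β f).coeff i) := by
  obtain ⟨N, hN⟩ := v.exists_bound_of_separable_quartic hmonic hdeg hsep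
  obtain ⟨M, hM0, hM⟩ := v.exists_le_map_coeff f 4
  obtain ⟨n, hn, hmax⟩ := Int.exists_greatest_of_bdd
    (P := fun n => ∃ β : K, ∀ i : ℕ, i < 4 → (((4 - i) * n : ℤ) : WithTop ℤ) ≤ v ((taylor β f).coeff i))
    ⟨N, fun n ⟨β, h⟩ => hN n β h⟩ ⟨M, 0, fun i hi => by
      rw [taylor_zero]
      refine le_trans (WithTop.coe_le_coe.2 ?_) (hM i hi)
      interval_cases i <;> push_cast <;> omega⟩
  exact ⟨n, hn, fun β hβ => absurd (hmax _ ⟨β, hβ⟩) (by omega)⟩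

theorem AddValuation.le_map_coeff_quartic_transform_iff (f : K[X]) {α : K} (β : K) {n : ℤ}
    (hα : v α = (n : WithTop ℤ)) {i : ℕ} (hi : i ≤ 4) (k : ℤ) :
    (k : WithTop ℤ) ≤ v ((C (α⁻¹ ^ 4) * f.comp (C α * X + C β)).coeff i) ↔
      ((k + (4 - i) * n : ℤ) : WithTop ℤ) ≤ v ((taylor β f).coeff i) := by
  have hα0 : α ≠ 0 := by rintro rfl; simp at hα
  rw [coeff_taylor_eq_coeff_quartic_transform_mul f β hα0 hi, v.map_mul,
    v.map_pow_of_eq_coe hα, Nat.cast_sub hi]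
  generalize v ((C (α⁻¹ ^ 4) * f.comp (C α * X + C β)).coeff i) = x
  cases x with
  | top => simp
  | coe x => norm_cast; constructor <;> intro h <;> linarith

end

/-- Every monic separable quartic `f` over a discretely valued field `(K, v)` is equivalent
to a reduced quartic: there are `α ≠ 0` and `β` such that `g = α⁻⁴·f(αx + β)` is integral,
has `λ(g) < 1`, and, if `λ(g) = 0`, its image in the residue field is not the fourth power
of a monic linear polynomial. -/
theorem exists_reduced_quartic_equivalent
    {K : Type*} [Field K] (v : AddValuation K (WithTop ℤ))
    (hsurj : ∀ n : ℤ, ∃ x : K, v x = (n : WithTop ℤ))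
    (f : K[X]) (hmonic : f.Monic) (hdeg : f.natDegree = 4) (hsep : f.Separable) :
    ∃ α β : K, α ≠ 0 ∧
      ∀ g : K[X], g = C (α⁻¹ ^ 4) * f.comp (C α * X + C β) →
        (∀ n : ℕ, 0 ≤ v (g.coeff n)) ∧
        (v (g.coeff 3) < 1 ∨ v (g.coeff 2) < 2 ∨ v (g.coeff 1) < 3 ∨ v (g.coeff 0) < 4) ∧
        ((v (g.coeff 3) = 0 ∨ v (g.coeff 2) = 0 ∨ v (g.coeff 1) = 0 ∨ v (g.coeff 0) = 0) →
          ¬ ∃ a : K, 0 ≤ v a ∧ ∀ n : ℕ, 0 < v ((g.comp (X + C a) - X ^ 4).coeff n)) := by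
  obtain ⟨n, ⟨β₀, hβ₀⟩, hmax⟩ := v.exists_greatest_slope_bound hmonic hdeg hsep
  obtain ⟨α, hα⟩ := hsurj n
  have hα0 : α ≠ 0 := by rintro rfl; simp at hα
  have hpos (x : WithTop ℤ) : 0 < x ↔ ((1 : ℤ) : WithTop ℤ) ≤ x := by
    cases x with
    | top => simp
    | coe x => norm_cast
  obtain ⟨β, hβ, hstrict⟩ : ∃ β : K,
      (∀ i : ℕ, i < 4 → (((4 - i) * n : ℤ) : WithTop ℤ) ≤ v ((taylor β f).coeff i)) ∧
      ((∃ γ : K, ∀ i : ℕ, i < 4 → ((1 + (4 - i) * n : ℤ) : WithTop ℤ) ≤ v ((taylor γ f).coeff i)) →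
        ∀ i : ℕ, i < 4 → ((1 + (4 - i) * n : ℤ) : WithTop ℤ) ≤ v ((taylor β f).coeff i)) := by
    by_cases h : ∃ γ : K,
        ∀ i : ℕ, i < 4 → ((1 + (4 - i) * n : ℤ) : WithTop ℤ) ≤ v ((taylor γ f).coeff i)
    · obtain ⟨γ, hγ⟩ := h
      exact ⟨γ, fun i hi => le_trans (by norm_cast; omega) (hγ i hi), fun _ => hγ⟩
    · exact ⟨β₀, hβ₀, fun h' => absurd h' h⟩
  refine ⟨α, β, hα0, ?_⟩
  rintro g rfl
  refine ⟨fun i => ?_, ?_, ?_⟩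
  · rcases lt_trichotomy i 4 with hi | rfl | hi
    · refine (v.le_map_coeff_quartic_transform_iff f β hα hi.le 0).2 ?_
      rw [zero_add]
      exact hβ i hi
    · refine (v.le_map_coeff_quartic_transform_iff f β hα le_rfl 0).2 ?_
      have hlead : (taylor β f).coeff 4 = 1 := by
        have := coeff_taylor_natDegree (r := β) (f := f)
        rwa [hdeg, hmonic.leadingCoeff] at this
      simp [hlead]
    · rw [coeff_eq_zero_of_natDegree_lt, v.map_zero]
      · exact le_top
      · refine lt_of_le_of_lt (natDegree_C_mul_le _ _) (lt_of_le_of_lt natDegree_comp_le ?_)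
        rw [hdeg]
        have : (C α * X + C β).natDegree ≤ 1 := natDegree_linear_le
        omega
  · by_contra! h
    obtain ⟨h3, h2, h1, h0⟩ := h
    refine hmax β fun i hi => ?_
    rw [show (4 - i : ℤ) * (n + 1) = (4 - i) + (4 - i) * n by ring,
      ← v.le_map_coeff_quartic_transform_iff f β hα hi.le]
    interval_cases i
    · exact h0
    · exact h1
    · exact h2
    · exact h3
  · rintro hzero ⟨a, -, ha⟩
    have hβpos := hstrict ⟨α * a + β, fun i hi => by
      rw [← v.le_map_coeff_quartic_transform_iff f _ hα hi.le,
        ← quartic_transform_comp_X_add_C, ← hpos]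
      simpa [coeff_X_pow, hi.ne] using ha i⟩
    have hne (i : ℕ) (hi : i < 4) :
        v ((C (α⁻¹ ^ 4) * f.comp (C α * X + C β)).coeff i) ≠ 0 :=
      ((hpos _).2 ((v.le_map_coeff_quartic_transform_iff f β hα hi.le 1).2 (hβpos i hi))).ne'
    rcases hzero with h | h | h | h <;> exact hne _ (by norm_num) h
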